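/- Let n ≥ 0 be an integer. Then for every real number x, Σ_{k=0}^{n} B_k(x) E_{n-k}(x) − Σ_{l=2}^{n} C(n+1, l+1) (2^l + l − 1) (B_l/l) E_{n-l}(x) = (n+1) E_n(x). -/

import Mathlib

open Finset

/-- The `n`-th Bernoulli polynomial evaluated at a real `x`:
`B_n(x) = ∑_{k=0}^n (n choose k) B_k x^(n-k)`, where `B_k` is the `k`-th Bernoulli number
(with the convention `B_1 = -1/2`, i.e. generating function `z e^{xz}/(e^z - 1)`). -/
noncomputable def bernoulliPoly (n : ℕ) (x : ℝ) : ℝ :=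
  ∑ k ∈ Finset.range (n + 1), ((bernoulli k : ℚ) : ℝ) * (n.choose k : ℝ) * x ^ (n - k)

/-- The `n`-th harmonic number `H_n = ∑_{k=1}^n 1/k` as a real number. -/
noncomputable def harm (n : ℕ) : ℝ :=
  ∑ k ∈ Finset.range n, (1 : ℝ) / (k + 1)

/-- The `n`-th Euler polynomial evaluated at a real `x`, defined via the classical identity
`E_n(x) = (2/(n+1)) * (B_{n+1}(x) - 2^{n+1} B_{n+1}(x/2))`, which is equivalent to the
generating-function definition `2 e^{xz}/(e^z + 1) = ∑ E_n(x) z^n/n!`. -/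
noncomputable def eulerPoly (n : ℕ) (x : ℝ) : ℝ :=
  2 / (n + 1) * (bernoulliPoly (n + 1) x - 2 ^ (n + 1) * bernoulliPoly (n + 1) (x / 2))

lemma bP_eq (n : ℕ) (x : ℝ) : bernoulliPoly n x = bernoulliFun n x := by
  unfold bernoulliPoly bernoulliFun Polynomial.bernoulli
  rw [Polynomial.map_sum, Polynomial.eval_finsetSum]
  refine Finset.sum_congr rfl fun k _ => ?_
  simp

lemma bP_deriv (n : ℕ) (x : ℝ) :
    HasDerivAt (bernoulliPoly n) (n * bernoulliPoly (n - 1) x) x := by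
  have h : bernoulliPoly n = bernoulliFun n := funext (bP_eq n)
  rw [h, bP_eq]
  exact hasDerivAt_bernoulliFun n x

lemma eP_zero (x : ℝ) : eulerPoly 0 x = 1 := by
  simp only [eulerPoly, bP_eq, zero_add, bernoulliFun_one]
  push_cast
  ring

lemma eP_deriv (n : ℕ) (x : ℝ) :
    HasDerivAt (eulerPoly n) (n * eulerPoly (n - 1) x) x := by
  cases n with
  | zero =>
    have h : eulerPoly 0 = fun _ => 1 := funext eP_zero
    rw [h]
    simpa using hasDerivAt_const x (1 : ℝ)
  | succ m =>
    have h1 := bP_deriv (m + 1 + 1) x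
    have h2 := (bP_deriv (m + 1 + 1) (x / 2)).comp x ((hasDerivAt_id x).div_const 2)
    have h3 := (h1.sub (h2.const_mul ((2 : ℝ) ^ (m + 1 + 1)))).const_mul
      (2 / (((m + 1 : ℕ) : ℝ) + 1))
    refine (h3.congr_deriv ?_)
    simp only [eulerPoly, Nat.add_sub_cancel]
    have : (m : ℝ) + 1 ≠ 0 := by positivity
    have : (m : ℝ) + 1 + 1 ≠ 0 := by positivity
    push_cast
    field_simp
    ring

lemma bP_at_zero (n : ℕ) : bernoulliPoly n 0 = bernoulli n := by
  rw [bP_eq, bernoulliFun_eval_zero]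

lemma bP_at_one (n : ℕ) : bernoulliPoly n 1 = bernoulliPoly n 0 + if n = 1 then 1 else 0 := by
  rw [bP_eq, bP_eq, bernoulliFun_eval_one]

lemma eP_at_zero (n : ℕ) :
    eulerPoly n 0 = 2 / (n + 1) * (1 - 2 ^ (n + 1)) * bernoulli (n + 1) := by
  rw [eulerPoly, zero_div, bP_at_zero]
  ring

lemma eP_at_one (n : ℕ) : eulerPoly n 1 = - eulerPoly n 0 + if n = 0 then 2 else 0 := by
  rcases n with _ | n
  · rw [eP_zero, eP_zero]; norm_num
  · rw [eP_at_zero, eulerPoly, bP_at_one, bP_at_zero, bP_eq, one_div, bernoulliFun_eval_half]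
    simp only [Nat.add_eq_right, Nat.add_eq_zero_iff, one_ne_zero, and_false, if_false]
    field_simp
    ring

noncomputable def cc (l : ℕ) : ℝ :=
  if l = 0 then 1 else if l = 1 then 0 else
    ((2 : ℝ) ^ l + (l : ℝ) - 1) * (((bernoulli l : ℚ) : ℝ) / (l : ℝ))

noncomputable def PP (n : ℕ) (x : ℝ) : ℝ :=
  ∑ k ∈ Finset.range (n + 1), bernoulliPoly k x * eulerPoly (n - k) x

noncomputable def QQ (n : ℕ) (x : ℝ) : ℝ :=
  ∑ l ∈ Finset.range (n + 1), ((n + 1).choose (l + 1) : ℝ) * cc l * eulerPoly (n - l) x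

lemma PP_deriv (n : ℕ) (x : ℝ) : HasDerivAt (PP (n + 1)) ((n + 2) * PP n x) x := by
  have h : HasDerivAt (PP (n + 1)) (∑ k ∈ Finset.range (n + 1 + 1),
      ((k * bernoulliPoly (k - 1) x) * eulerPoly (n + 1 - k) x +
        bernoulliPoly k x * (((n + 1 - k : ℕ) : ℝ) * eulerPoly (n + 1 - k - 1) x))) x := by
    unfold PP
    exact HasDerivAt.fun_sum fun k _ => (bP_deriv k x).mul (eP_deriv _ x)
  refine h.congr_deriv ?_
  rw [Finset.sum_add_distrib, Finset.sum_range_succ', Finset.sum_range_succ _ (n + 1)]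
  simp only [Nat.cast_zero, zero_mul, add_zero, Nat.sub_self, mul_zero]
  rw [← Finset.sum_add_distrib, PP, Finset.mul_sum]
  refine Finset.sum_congr rfl fun k hk => ?_
  have hk' : k ≤ n := by simpa [Nat.lt_succ_iff] using hk
  have e1 : n + 1 - (k + 1) = n - k := by omega
  have e2 : n + 1 - k - 1 = n - k := by omega
  have e3 : ((n + 1 - k : ℕ) : ℝ) = n + 1 - k := by
    rw [Nat.cast_sub (by omega)]; push_cast; ring
  rw [e1, e2, e3, Nat.add_sub_cancel]
  push_cast
  ring

lemma QQ_deriv (n : ℕ) (x : ℝ) : HasDerivAt (QQ (n + 1)) ((n + 2) * QQ n x) x := by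
  have h : HasDerivAt (QQ (n + 1)) (∑ l ∈ Finset.range (n + 1 + 1),
      (((n + 1 + 1).choose (l + 1) : ℝ) * cc l *
        (((n + 1 - l : ℕ) : ℝ) * eulerPoly (n + 1 - l - 1) x))) x := by
    unfold QQ
    exact HasDerivAt.fun_sum fun k _ => (eP_deriv _ x).const_mul _
  refine h.congr_deriv ?_
  rw [Finset.sum_range_succ _ (n + 1)]
  simp only [Nat.cast_zero, zero_mul, add_zero, Nat.sub_self, mul_zero]
  rw [QQ, Finset.mul_sum]
  refine Finset.sum_congr rfl fun k hk => ?_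
  have hk' : k ≤ n := by simpa [Nat.lt_succ_iff] using hk
  have e2 : n + 1 - k - 1 = n - k := by omega
  have e3 : ((n + 1 + 1).choose (k + 1) : ℝ) * ((n + 1 - k : ℕ) : ℝ)
      = (n + 2) * ((n + 1).choose (k + 1) : ℝ) := by
    have := Nat.choose_mul_succ_eq (n + 1) (k + 1)
    have e : n + 1 + 1 - (k + 1) = n + 1 - k := by omega
    rw [e] at this
    have h2 : ((n + 1).choose (k + 1) : ℝ) * ((n + 1 + 1 : ℕ) : ℝ)
      = ((n + 1 + 1).choose (k + 1) : ℝ) * ((n + 1 - k : ℕ) : ℝ) := by exact_mod_cast this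
    rw [← h2]; push_cast; ring
  rw [e2]
  linear_combination (cc k * eulerPoly (n - k) x) * e3

lemma PP_sum (n : ℕ) : PP (n + 1) 0 + PP (n + 1) 1 = 2 * cc (n + 1) := by
  have h : PP (n + 1) 0 + PP (n + 1) 1 = ∑ k ∈ Finset.range (n + 1 + 1),
      ((if k = n + 1 then 2 * bernoulliPoly k 1 else 0)
        - if k = 1 then eulerPoly (n + 1 - k) 0 else 0) := by
    rw [PP, PP, ← Finset.sum_add_distrib]
    refine Finset.sum_congr rfl fun k hk => ?_
    have hk' : k ≤ n + 1 := by simpa [Nat.lt_succ_iff] using hk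
    have : n + 1 - k = 0 ↔ k = n + 1 := by omega
    rw [eP_at_one, bP_at_one]
    simp only [this]
    split_ifs <;> ring
  rw [h, Finset.sum_sub_distrib, Finset.sum_ite_eq', Finset.sum_ite_eq', if_pos (by simp),
    if_pos (by simp), Nat.add_sub_cancel, bP_at_one, bP_at_zero, eP_at_zero, cc]
  rcases n with _ | n
  · norm_num
  · simp only [Nat.add_eq_right, Nat.add_eq_zero_iff, one_ne_zero, and_false, if_false]
    have : (n : ℝ) + 1 + 1 ≠ 0 := by positivity
    push_cast
    field_simp
    ring

lemma QQ_sum (n : ℕ) : QQ n 0 + QQ n 1 = 2 * cc n := by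
  have h : QQ n 0 + QQ n 1 = ∑ k ∈ Finset.range (n + 1),
      (if k = n then 2 * cc n else 0) := by
    rw [QQ, QQ, ← Finset.sum_add_distrib]
    refine Finset.sum_congr rfl fun k hk => ?_
    have hk' : k ≤ n := by simpa [Nat.lt_succ_iff] using hk
    have : n - k = 0 ↔ k = n := by omega
    rw [eP_at_one]
    simp only [this]
    split_ifs with h
    · subst h; simp; ring
    · ring
  rw [h, Finset.sum_ite_eq', if_pos (by simp)]

lemma PP_eq_QQ (n : ℕ) : ∀ x, PP n x = QQ n x := by
  induction n with
  | zero => intro x; simp [PP, QQ, cc, bP_eq]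
  | succ n ih =>
    have hd : ∀ x, HasDerivAt (fun y => PP (n + 1) y - QQ (n + 1) y) 0 x := fun x => by
      refine ((PP_deriv n x).sub (QQ_deriv n x)).congr_deriv ?_
      rw [ih x]; ring
    have hc : ∀ x y, PP (n + 1) x - QQ (n + 1) x = PP (n + 1) y - QQ (n + 1) y :=
      is_const_of_deriv_eq_zero (fun x => (hd x).differentiableAt) (fun x => (hd x).deriv)
    intro x
    have h1 := hc x 0
    have h2 := hc x 1
    have h3 := PP_sum n
    have h4 := QQ_sum (n + 1)
    linarith

theorem stmt_14 (n : ℕ) (x : ℝ) :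
    (∑ k ∈ Finset.range (n + 1), bernoulliPoly k x * eulerPoly (n - k) x) -
      (∑ l ∈ Finset.Icc 2 n, ((n + 1).choose (l + 1) : ℝ) * ((2 : ℝ) ^ l + (l : ℝ) - 1) *
        (((bernoulli l : ℚ) : ℝ) / (l : ℝ)) * eulerPoly (n - l) x) =
    ((n : ℝ) + 1) * eulerPoly n x := by
  have h := PP_eq_QQ n x
  unfold PP at h
  rw [h, QQ, Finset.sum_range_succ']
  have e : ∑ l ∈ Finset.Icc 2 n, ((n + 1).choose (l + 1) : ℝ) * ((2 : ℝ) ^ l + (l : ℝ) - 1) *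
        (((bernoulli l : ℚ) : ℝ) / (l : ℝ)) * eulerPoly (n - l) x =
      ∑ l ∈ Finset.Icc 1 n, ((n + 1).choose (l + 1) : ℝ) * cc l * eulerPoly (n - l) x := by
    rw [← Finset.sum_subset (Finset.Icc_subset_Icc_left (by norm_num : 1 ≤ 2))]
    · refine Finset.sum_congr rfl fun l hl => ?_
      rw [Finset.mem_Icc] at hl
      rw [cc, if_neg (by omega), if_neg (by omega)]
      ring
    · intro l h1 h2
      rw [Finset.mem_Icc] at h1 h2
      have : l = 1 := by omega
      simp [this, cc]
  rw [e, Finset.range_eq_Ico, Finset.sum_Ico_add' (fun l => ((n + 1).choose (l + 1) : ℝ) * cc l * eulerPoly (n - l) x) 0 n 1]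
  have : Finset.Ico (0 + 1) (n + 1) = Finset.Icc 1 n := by ext; simp [Nat.lt_succ_iff]
  rw [this]
  simp [cc]
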